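/- arXiv:1311.2812 — 2 statements merged into one kernel-verified Lean document; each statement's English description precedes it below -/
import Mathlib

section
/- Let d ≥ 2, let Ω ⊂ ℝ^d be a bounded convex open set, and let v : ℝ^d → ℝ be of class C². Suppose there are constants 0 < r ≤ R such that r ≤ λ₁(D²v(x)) and λ_d(D²v(x)) ≤ R for all x ∈ cl(Ω). Then there exists h₀ ∈ (0,1) such that for every 0 < h ≤ h₀ and every x ∈ Ω_h⁰ one has r/2 ≤ λ₁(sym H_d(r_h v)(x)) and λ_d(sym H_d(r_h v)(x)) ≤ 3R/2. -/
noncomputable section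

namespace MA

variable {d : ℕ}

/-- the `i`-th standard basis vector of `ℝ^d`. -/
def bv (d : ℕ) (i : Fin d) : Fin d → ℝ := Pi.single i 1

def lamMin (A : Matrix (Fin d) (Fin d) ℝ) : ℝ := sInf (spectrum ℝ A)

def lamMax (A : Matrix (Fin d) (Fin d) ℝ) : ℝ := sSup (spectrum ℝ A)

def symPart (A : Matrix (Fin d) (Fin d) ℝ) : Matrix (Fin d) (Fin d) ℝ :=
  (1 / 2 : ℝ) • (A + A.transpose)

/-- the cofactor matrix: `Aᵀ * cof A = det A • 1`. -/
def cof (A : Matrix (Fin d) (Fin d) ℝ) : Matrix (Fin d) (Fin d) ℝ :=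
  (Matrix.adjugate A).transpose

/-- forward difference quotient `∂₊^i`. -/
def dp (h : ℝ) (i : Fin d) (v : (Fin d → ℝ) → ℝ) (x : Fin d → ℝ) : ℝ :=
  (v (x + h • bv d i) - v x) / h

/-- backward difference quotient `∂₋^i`. -/
def dm (h : ℝ) (i : Fin d) (v : (Fin d → ℝ) → ℝ) (x : Fin d → ℝ) : ℝ :=
  (v x - v (x - h • bv d i)) / h

/-- the discrete Hessian `H_d(v)(x)` with entries `∂₋^j ∂₊^i v(x)`. -/
def Hd (h : ℝ) (v : (Fin d → ℝ) → ℝ) (x : Fin d → ℝ) : Matrix (Fin d) (Fin d) ℝ :=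
  Matrix.of fun i j => dm h j (fun y => dp h i v y) x

/-- the discrete Hessian `Ĥ_d(v)(x)` with entries `∂₋^j ∂₋^i v(x)`. -/
def Hhat (h : ℝ) (v : (Fin d → ℝ) → ℝ) (x : Fin d → ℝ) : Matrix (Fin d) (Fin d) ℝ :=
  Matrix.of fun i j => dm h j (fun y => dm h i v y) x

/-- the central discrete Hessian `H̄_d(v)(x)`. -/
def Hc (h : ℝ) (v : (Fin d → ℝ) → ℝ) (x : Fin d → ℝ) : Matrix (Fin d) (Fin d) ℝ :=
  Matrix.of fun i j =>
    if i = j then (v (x + h • bv d i) - 2 * v x + v (x - h • bv d i)) / h ^ 2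
    else (v (x + h • bv d i + h • bv d j) - v (x + h • bv d i - h • bv d j)
          - v (x - h • bv d i + h • bv d j) + v (x - h • bv d i - h • bv d j)) / (4 * h ^ 2)

/-- the discrete gradient `D_h v = (∂₊^1 v, …, ∂₊^d v)`. -/
def Dh (h : ℝ) (v : (Fin d → ℝ) → ℝ) (x : Fin d → ℝ) : Fin d → ℝ := fun i => dp h i v x

/-- the discrete divergence `div_h w = Σ_i ∂₋^i w_i`. -/
def divh (h : ℝ) (w : (Fin d → ℝ) → Fin d → ℝ) (x : Fin d → ℝ) : ℝ :=
  ∑ i, dm h i (fun y => w y i) x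

/-- the discrete Laplacian `Δ_h v = Σ_i ∂₊^i ∂₋^i v`. -/
def lapH (h : ℝ) (v : (Fin d → ℝ) → ℝ) (x : Fin d → ℝ) : ℝ :=
  ∑ i, dp h i (fun y => dm h i v y) x

/-- the grid `ℤ_h = {x : x_i / h ∈ ℤ}`. -/
def gridZ (d : ℕ) (h : ℝ) : Set (Fin d → ℝ) := {x | ∀ i, ∃ k : ℤ, x i = (k : ℝ) * h}

/-- `Ω_h = cl(Ω) ∩ ℤ_h`. -/
def OmegaH (Ω : Set (Fin d → ℝ)) (h : ℝ) : Set (Fin d → ℝ) := closure Ω ∩ gridZ d h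

/-- `Ω_h⁰ = {x ∈ Ω_h : x ± h e_i ± h e_j ∈ cl(Ω) for all i,j}`. -/
def OmegaH0 (Ω : Set (Fin d → ℝ)) (h : ℝ) : Set (Fin d → ℝ) :=
  {x | x ∈ OmegaH Ω h ∧ ∀ i j : Fin d, ∀ s t : Bool,
    x + (if s then h else -h) • bv d i + (if t then h else -h) • bv d j ∈ closure Ω}

/-- the discrete seminorm `|v|_{1,h}`. -/
def snorm1h (Ω : Set (Fin d → ℝ)) (h : ℝ) (v : (Fin d → ℝ) → ℝ) : ℝ :=
  Real.sqrt (∑ i : Fin d, h ^ d * ∑ᶠ x ∈ OmegaH0 Ω h, (dp h i v x) ^ 2)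

/-- the Hessian matrix `D²v(x)` of second partial derivatives. -/
def hess (v : (Fin d → ℝ) → ℝ) (x : Fin d → ℝ) : Matrix (Fin d) (Fin d) ℝ :=
  Matrix.of fun i j => iteratedFDeriv ℝ 2 v x ![bv d i, bv d j]

/-- the compatible discrete Monge–Ampère operator
`(1/d) div_h [(cof sym H_d v) D_h v]`. -/
def MAh (h : ℝ) (v : (Fin d → ℝ) → ℝ) (x : Fin d → ℝ) : ℝ :=
  (1 / (d : ℝ)) * divh h (fun y => (cof (symPart (Hd h v y))).mulVec (Dh h v y)) x

end MA

namespace MA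

open scoped Matrix

section Spectral

variable {d : ℕ} {A : Matrix (Fin d) (Fin d) ℝ}

lemma spectrum_finite (hA : A.IsHermitian) : (spectrum ℝ A).Finite := by
  rw [hA.spectrum_real_eq_range_eigenvalues]
  exact Set.finite_range _

lemma spectrum_nonempty [NeZero d] (hA : A.IsHermitian) : (spectrum ℝ A).Nonempty := by
  rw [hA.spectrum_real_eq_range_eigenvalues]
  exact Set.range_nonempty _

lemma isHermitian_smul_one (c : ℝ) : (c • (1 : Matrix (Fin d) (Fin d) ℝ)).IsHermitian := by
  simp [Matrix.IsHermitian]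

lemma posSemidef_sub_smul_one_iff (hA : A.IsHermitian) (r : ℝ) :
    (A - r • (1 : Matrix (Fin d) (Fin d) ℝ)).PosSemidef ↔ ∀ a ∈ spectrum ℝ A, r ≤ a := by
  rw [Matrix.posSemidef_iff_isHermitian_and_spectrum_nonneg,
    ← Algebra.algebraMap_eq_smul_one, ← spectrum.sub_singleton_eq, Algebra.algebraMap_eq_smul_one,
    and_iff_right (hA.sub (isHermitian_smul_one r))]
  simp [Set.subset_def]

lemma posSemidef_smul_one_sub_iff (hA : A.IsHermitian) (R : ℝ) :
    (R • (1 : Matrix (Fin d) (Fin d) ℝ) - A).PosSemidef ↔ ∀ a ∈ spectrum ℝ A, a ≤ R := by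
  rw [Matrix.posSemidef_iff_isHermitian_and_spectrum_nonneg,
    ← Algebra.algebraMap_eq_smul_one, ← spectrum.singleton_sub_eq, Algebra.algebraMap_eq_smul_one,
    and_iff_right ((isHermitian_smul_one R).sub hA)]
  simp [Set.subset_def]

lemma le_lamMin_iff [NeZero d] (hA : A.IsHermitian) (r : ℝ) :
    r ≤ lamMin A ↔ (A - r • (1 : Matrix (Fin d) (Fin d) ℝ)).PosSemidef := by
  rw [posSemidef_sub_smul_one_iff hA]
  exact le_csInf_iff (spectrum_finite hA).bddBelow (spectrum_nonempty hA)

lemma lamMax_le_iff [NeZero d] (hA : A.IsHermitian) (R : ℝ) :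
    lamMax A ≤ R ↔ (R • (1 : Matrix (Fin d) (Fin d) ℝ) - A).PosSemidef := by
  rw [posSemidef_smul_one_sub_iff hA]
  exact csSup_le_iff (spectrum_finite hA).bddAbove (spectrum_nonempty hA)

lemma posSemidef_smul_one_add_of_abs_le {B : Matrix (Fin d) (Fin d) ℝ} (hB : B.IsHermitian)
    {c ε : ℝ} (hBε : ∀ i j, |B i j| ≤ ε) (hc : d * ε ≤ c) :
    (c • (1 : Matrix (Fin d) (Fin d) ℝ) + B).PosSemidef := by
  refine .of_dotProduct_mulVec_nonneg ((isHermitian_smul_one c).add hB) fun x ↦ ?_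
  have hquad : -(d * ε * ∑ i, x i ^ 2) ≤ x ⬝ᵥ (B *ᵥ x) := by
    calc -(d * ε * ∑ i, x i ^ 2) = ∑ i, ∑ j, -(ε * ((x i ^ 2 + x j ^ 2) / 2)) := by
          simp only [Finset.sum_neg_distrib, ← Finset.mul_sum, ← Finset.sum_div,
            Finset.sum_add_distrib, Finset.sum_const, Finset.card_univ, Fintype.card_fin,
            nsmul_eq_mul]
          ring
      _ ≤ ∑ i, ∑ j, x i * (B i j * x j) := by
          refine Finset.sum_le_sum fun i _ ↦ Finset.sum_le_sum fun j _ ↦ ?_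
          have hxx : |x i * x j| ≤ (x i ^ 2 + x j ^ 2) / 2 :=
            abs_le.2 ⟨by nlinarith [sq_nonneg (x i + x j)], by nlinarith [sq_nonneg (x i - x j)]⟩
          have hmul : |B i j * (x i * x j)| ≤ ε * ((x i ^ 2 + x j ^ 2) / 2) := by
            rw [abs_mul]
            exact mul_le_mul (hBε i j) hxx (abs_nonneg _) ((abs_nonneg _).trans (hBε i j))
          linarith [neg_abs_le (B i j * (x i * x j))]
      _ = x ⬝ᵥ (B *ᵥ x) := by
          simp only [dotProduct, Matrix.mulVec, Finset.mul_sum]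
  have hself : x ⬝ᵥ x = ∑ i, x i ^ 2 := by simp [dotProduct, sq]
  have hnonneg : 0 ≤ ∑ i, x i ^ 2 := Finset.sum_nonneg fun i _ ↦ sq_nonneg _
  rw [star_trivial, Matrix.add_mulVec, Matrix.smul_mulVec, Matrix.one_mulVec, dotProduct_add,
    dotProduct_smul, hself, smul_eq_mul]
  nlinarith [mul_le_mul_of_nonneg_right hc hnonneg]

lemma isHermitian_symPart (A : Matrix (Fin d) (Fin d) ℝ) : (symPart A).IsHermitian := by
  simp [symPart, Matrix.IsHermitian, add_comm]

lemma abs_symPart_sub_le (hA : A.IsHermitian) {B : Matrix (Fin d) (Fin d) ℝ} {ε : ℝ}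
    (hBA : ∀ i j, |B i j - A i j| ≤ ε) (i j : Fin d) : |(symPart B - A) i j| ≤ ε := by
  have hij := abs_le.1 (hBA i j)
  have hji := abs_le.1 (hBA j i)
  have hsymm : A j i = A i j := by simpa using hA.apply i j
  rw [abs_le]
  simp only [symPart, Matrix.sub_apply, Matrix.smul_apply, Matrix.add_apply,
    Matrix.transpose_apply, smul_eq_mul]
  constructor <;> linarith

lemma le_lamMin_of_abs_sub_le [NeZero d] {B : Matrix (Fin d) (Fin d) ℝ} (hA : A.IsHermitian)
    (hB : B.IsHermitian) {r c ε : ℝ} (hr : r ≤ lamMin A) (hBA : ∀ i j, |(B - A) i j| ≤ ε)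
    (hc : d * ε ≤ c) : r - c ≤ lamMin B := by
  rw [le_lamMin_iff hA] at hr
  rw [le_lamMin_iff hB]
  have hadd := hr.add (posSemidef_smul_one_add_of_abs_le (hB.sub hA) hBA hc)
  convert hadd using 1
  module

lemma lamMax_le_of_abs_sub_le [NeZero d] {B : Matrix (Fin d) (Fin d) ℝ} (hA : A.IsHermitian)
    (hB : B.IsHermitian) {R c ε : ℝ} (hR : lamMax A ≤ R) (hBA : ∀ i j, |(B - A) i j| ≤ ε)
    (hc : d * ε ≤ c) : lamMax B ≤ R + c := by
  rw [lamMax_le_iff hA] at hR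
  rw [lamMax_le_iff hB]
  have hAB : ∀ i j, |(A - B) i j| ≤ ε := fun i j ↦ by
    simpa only [Matrix.sub_apply, abs_sub_comm] using hBA i j
  have hadd := hR.add (posSemidef_smul_one_add_of_abs_le (hA.sub hB) hAB hc)
  convert hadd using 1
  module

end Spectral

section Hessian

variable {d : ℕ} {v : (Fin d → ℝ) → ℝ}

lemma hess_apply (x : Fin d → ℝ) (i j : Fin d) :
    hess v x i j = fderiv ℝ (fderiv ℝ v) x (bv d i) (bv d j) := by
  simp [hess, iteratedFDeriv_two_apply]

lemma isHermitian_hess (hv : ContDiff ℝ 2 v) (x : Fin d → ℝ) : (hess v x).IsHermitian := by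
  ext i j
  simp only [Matrix.conjTranspose_apply, star_trivial, hess_apply]
  exact hv.contDiffAt.isSymmSndFDerivAt (by simp) _ _

lemma differentiable_fderiv (hv : ContDiff ℝ 2 v) : Differentiable ℝ (fderiv ℝ v) :=
  (hv.fderiv_right (m := 1) (by norm_num)).differentiable (by norm_num)

lemma continuous_hess (hv : ContDiff ℝ 2 v) :
    Continuous fun x (i j : Fin d) ↦ hess v x i j := by
  have hcont : Continuous (fderiv ℝ (fderiv ℝ v)) :=
    (hv.fderiv_right (m := 1) (by norm_num)).continuous_fderiv (by norm_num)
  simp only [hess_apply]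
  fun_prop

lemma hasDerivAt_comp_line {E F : Type*} [NormedAddCommGroup E] [NormedSpace ℝ E]
    [NormedAddCommGroup F] [NormedSpace ℝ F] {f : E → F} (hf : Differentiable ℝ f)
    (x e : E) (s : ℝ) : HasDerivAt (fun s : ℝ ↦ f (x + s • e)) (fderiv ℝ f (x + s • e) e) s := by
  have hline : HasDerivAt (fun s : ℝ ↦ x + s • e) e s := by
    simpa using ((hasDerivAt_id s).smul_const e).const_add x
  exact (hf (x + s • e)).hasFDerivAt.comp_hasDerivAt s hline

/-- The mean value theorem for the mixed second difference quotient. -/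
lemma exists_Hd_eq_hess (hv : ContDiff ℝ 2 v) {h : ℝ} (hh : 0 < h) (x : Fin d → ℝ)
    (i j : Fin d) :
    ∃ s ∈ Set.Ioo 0 h, ∃ t ∈ Set.Ioo (-h) 0,
      Hd h v x i j = hess v (x + s • bv d i + t • bv d j) i j := by
  have hdiff : Differentiable ℝ v := hv.differentiable (by norm_num)
  have hg : ∀ s : ℝ, HasDerivAt
      (fun s : ℝ ↦ v (x + s • bv d i) - v ((x - h • bv d j) + s • bv d i))
      (fderiv ℝ v (x + s • bv d i) (bv d i) -
        fderiv ℝ v ((x - h • bv d j) + s • bv d i) (bv d i)) s := fun s ↦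
    (hasDerivAt_comp_line hdiff _ _ s).sub (hasDerivAt_comp_line hdiff _ _ s)
  obtain ⟨s, hs, hs_eq⟩ := exists_hasDerivAt_eq_slope _ _ hh
    (fun s _ ↦ (hg s).continuousAt.continuousWithinAt) fun s _ ↦ hg s
  have hk : ∀ t : ℝ, HasDerivAt
      (fun t : ℝ ↦ fderiv ℝ v ((x + s • bv d i) + t • bv d j) (bv d i))
      (fderiv ℝ (fderiv ℝ v) ((x + s • bv d i) + t • bv d j) (bv d j) (bv d i)) t := fun t ↦ by
    simpa using (hasDerivAt_comp_line (differentiable_fderiv hv) (x + s • bv d i) (bv d j)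
      t).clm_apply (hasDerivAt_const t (bv d i))
  obtain ⟨t, ht, ht_eq⟩ := exists_hasDerivAt_eq_slope _ _ (neg_lt_zero.2 hh)
    (fun t _ ↦ (hk t).continuousAt.continuousWithinAt) fun t _ ↦ hk t
  refine ⟨s, hs, t, ht, ?_⟩
  have hpoint : x - h • bv d j + s • bv d i = x + s • bv d i + -h • bv d j := by module
  rw [hess_apply, hv.contDiffAt.isSymmSndFDerivAt (by simp) (bv d i), ht_eq]
  simp only [zero_smul, add_zero, sub_zero, sub_neg_eq_add, zero_add] at hs_eq ⊢
  rw [← hpoint, hs_eq]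
  simp only [Hd, dm, dp, Matrix.of_apply]
  field_simp
  ring

lemma dist_add_smul_bv_le (x : Fin d → ℝ) (i j : Fin d) {s t h : ℝ} (hs : |s| ≤ h)
    (ht : |t| ≤ h) : dist x (x + s • bv d i + t • bv d j) ≤ 2 * h := by
  have hnorm : ∀ k : Fin d, ‖bv d k‖ = 1 := fun k ↦ by simp [bv, Pi.norm_single]
  have heq : x + s • bv d i + t • bv d j = x + (s • bv d i + t • bv d j) := by module
  rw [heq, dist_self_add_right]
  refine (norm_add_le _ _).trans ?_
  rw [norm_smul, norm_smul, hnorm, hnorm, Real.norm_eq_abs, Real.norm_eq_abs]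
  linarith

lemma exists_forall_abs_Hd_sub_hess_le (hv : ContDiff ℝ 2 v) {K : Set (Fin d → ℝ)}
    (hK : IsCompact K) {ε : ℝ} (hε : 0 < ε) :
    ∃ δ > 0, ∀ h : ℝ, 0 < h → h < δ → ∀ x ∈ K, ∀ i j, |Hd h v x i j - hess v x i j| ≤ ε := by
  obtain ⟨δ, hδ, hclose⟩ := Metric.mem_uniformity_dist.1
    (hK.uniformContinuousAt_of_continuousAt _ (fun _ _ ↦ (continuous_hess hv).continuousAt)
      (Metric.dist_mem_uniformity hε))
  refine ⟨δ / 2, half_pos hδ, fun h hh hhδ x hx i j ↦ ?_⟩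
  obtain ⟨s, hs, t, ht, heq⟩ := exists_Hd_eq_hess hv hh x i j
  have hdist := dist_add_smul_bv_le x i j (abs_le.2 ⟨by linarith [hs.1], hs.2.le⟩)
    (abs_le.2 ⟨ht.1.le, by linarith [ht.2]⟩)
  have hlt := hclose (a := x) (b := x + s • bv d i + t • bv d j) (by linarith) hx
  rw [heq, ← Real.dist_eq, dist_comm]
  exact ((dist_le_pi_dist _ _ j).trans (dist_le_pi_dist _ _ i)).trans hlt.le

end Hessian

end MA

/-- if `r ≤ λ₁(D²v) ≤ λ_d(D²v) ≤ R` on `cl(Ω)` then for `h` small enough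
`r/2 ≤ λ₁(sym H_d(r_h v)) ≤ λ_d(sym H_d(r_h v)) ≤ 3R/2` on `Ω_h⁰`. -/
theorem stmt3 {d : ℕ} (hd : 2 ≤ d) (Ω : Set (Fin d → ℝ))
    (hΩo : IsOpen Ω) (hΩc : Convex ℝ Ω) (hΩb : Bornology.IsBounded Ω)
    (v : (Fin d → ℝ) → ℝ) (hv : ContDiff ℝ 2 v)
    (r R : ℝ) (hr : 0 < r) (hrR : r ≤ R)
    (hlow : ∀ x ∈ closure Ω, r ≤ MA.lamMin (MA.hess v x))
    (hup : ∀ x ∈ closure Ω, MA.lamMax (MA.hess v x) ≤ R) :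
    ∃ h0 : ℝ, 0 < h0 ∧ h0 < 1 ∧
      ∀ h : ℝ, 0 < h → h ≤ h0 → ∀ x ∈ MA.OmegaH0 Ω h,
        r / 2 ≤ MA.lamMin (MA.symPart (MA.Hd h v x)) ∧
        MA.lamMax (MA.symPart (MA.Hd h v x)) ≤ 3 * R / 2 := by
  have : NeZero d := ⟨by omega⟩
  have hd0 : (0 : ℝ) < d := by exact_mod_cast (by omega : 0 < d)
  obtain ⟨δ, hδ, hclose⟩ := MA.exists_forall_abs_Hd_sub_hess_le hv hΩb.isCompact_closure
    (div_pos (half_pos hr) hd0)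
  have hc : d * (r / 2 / d) ≤ r / 2 := (mul_div_cancel₀ _ hd0.ne').le
  refine ⟨min (δ / 2) (1 / 2), by positivity, (min_le_right _ _).trans_lt (by norm_num),
    fun h hh hh0 x hx ↦ ?_⟩
  have hhδ : h < δ := (hh0.trans (min_le_left _ _)).trans_lt (half_lt_self hδ)
  have hxΩ : x ∈ closure Ω := hx.1.1
  have hA := MA.isHermitian_hess hv x
  have hB := MA.isHermitian_symPart (MA.Hd h v x)
  have hBA := MA.abs_symPart_sub_le hA (hclose h hh hhδ x hxΩ)
  have hmin := MA.le_lamMin_of_abs_sub_le hA hB (hlow x hxΩ) hBA hc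
  have hmax := MA.lamMax_le_of_abs_sub_le hA hB (hup x hxΩ) hBA hc
  constructor <;> linarith
end
end

section
/- Let d ≥ 2, let U ⊂ ℝ^d be open, and let v : U → ℝ be of class C³. Then for every x ∈ U, d · det D²v(x) = Σ_{i=1}^d ∂/∂x_i [ Σ_{j=1}^d (cof D²v)_{ij} (∂v/∂x_j) ](x); equivalently, det D²v = (1/d) div[(cof D²v) Dv] on U, where Dv is the gradient of v and the divergence of a C¹ vector field F = (F_1,…,F_d) is Σ_{i=1}^d ∂F_i/∂x_i. -/
noncomputable section

/-- The determinant as a continuous multilinear function of the rows. -/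
def Matrix.detRowContinuousMultilinear (n : Type*) [Fintype n] [DecidableEq n] :
    ContinuousMultilinearMap ℝ (fun _ : n => n → ℝ) ℝ where
  toMultilinearMap := (Matrix.detRowAlternating (R := ℝ) (n := n)).toMultilinearMap
  cont := Continuous.matrix_det (A := fun M : Matrix n n ℝ => M) continuous_id

/-- Derivative of a determinant, row by row. -/
theorem HasFDerivAt.det_apply {n E : Type*} [Fintype n] [DecidableEq n]
    [NormedAddCommGroup E] [NormedSpace ℝ E] {A : E → Matrix n n ℝ}
    {A' : n → E →L[ℝ] n → ℝ} {x : E} (hA : ∀ k, HasFDerivAt (fun y => A y k) (A' k) x) (a : E) :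
    fderiv ℝ (fun y => (A y).det) x a = ∑ k, ((A x).updateRow k (A' k a)).det := by
  have h := HasFDerivAt.multilinear_comp (f := Matrix.detRowContinuousMultilinear n) hA
  have h' : fderiv ℝ (fun y => (A y).det) x = _ := h.fderiv
  rw [h', sum_apply]
  rfl

/-- Replacing row `i` by `g` and row `k` by `W i k`, with `W` symmetric in `i, k`, gives determinants
that are antisymmetric in `i, k`, so that their sum vanishes. -/
theorem Matrix.sum_sum_det_updateRow_updateRow_eq_zero {n : Type*} [Fintype n] [DecidableEq n]
    (A : Matrix n n ℝ) (g : n → ℝ) (W : n → n → n → ℝ) (hW : ∀ i k, W i k = W k i) :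
    ∑ i, ∑ k, (if k = i then 0 else ((A.updateRow i g).updateRow k (W i k)).det) = 0 := by
  set f : n → n → ℝ :=
    fun i k => if k = i then 0 else ((A.updateRow i g).updateRow k (W i k)).det with hf
  have hanti : ∀ i k, f i k = -f k i := by
    intro i k
    by_cases hki : k = i
    · simp [hf, hki]
    · simp only [hf, if_neg hki, if_neg (Ne.symm hki)]
      rw [hW k i]
      have hswap : (A.updateRow k g).updateRow i (W i k) =
          ((A.updateRow i g).updateRow k (W i k)).submatrix (Equiv.swap i k) id := by
        ext a b
        rcases eq_or_ne a i with rfl | hai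
        · simp
        · rcases eq_or_ne a k with rfl | hak
          · simp [hai, Ne.symm hai]
          · simp [Equiv.swap_apply_of_ne_of_ne hai hak, hai, hak]
      rw [hswap, Matrix.det_permute, Equiv.Perm.sign_swap (Ne.symm hki)]
      simp
  have hsum : ∑ i, ∑ k, f i k = -∑ i, ∑ k, f i k := by
    conv_lhs => rw [Finset.sum_comm]
    simp only [← Finset.sum_neg_distrib]
    exact Finset.sum_congr rfl fun i _ => Finset.sum_congr rfl fun k _ => hanti k i
  linarith

namespace MA

theorem sum_cof_mul {d : ℕ} (A : Matrix (Fin d) (Fin d) ℝ) (g : Fin d → ℝ) (i : Fin d) :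
    ∑ j, cof A i j * g j = (A.updateRow i g).det := by
  rw [← Matrix.cramer_transpose_apply, Matrix.cramer_eq_adjugate_mulVec,
    ← Matrix.adjugate_transpose]
  rfl

/-- The components of a linear functional in the standard basis. -/
def components (d : ℕ) : ((Fin d → ℝ) →L[ℝ] ℝ) →L[ℝ] Fin d → ℝ :=
  ContinuousLinearMap.pi fun l => ContinuousLinearMap.apply ℝ ℝ (bv d l)

theorem components_apply {d : ℕ} (φ : (Fin d → ℝ) →L[ℝ] ℝ) (l : Fin d) :
    components d φ l = φ (bv d l) := rfl

theorem hess_row {d : ℕ} (v : (Fin d → ℝ) → ℝ) (x : Fin d → ℝ) (k : Fin d) :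
    hess v x k = components d (fderiv ℝ (fderiv ℝ v) x (bv d k)) := by
  ext l
  simp [hess, components_apply, iteratedFDeriv_two_apply]

end MA

/-- for `v` of class `C³` on an open set `U`,
`d · det D²v = div[(cof D²v) Dv]` on `U`. -/
theorem stmt7 {d : ℕ} (hd : 2 ≤ d) (U : Set (Fin d → ℝ)) (hU : IsOpen U)
    (v : (Fin d → ℝ) → ℝ) (hv : ContDiffOn ℝ 3 v U) :
    ∀ x ∈ U,
      (d : ℝ) * (MA.hess v x).det =
        ∑ i : Fin d,
          fderiv ℝ
            (fun y => ∑ j : Fin d, MA.cof (MA.hess v y) i j * fderiv ℝ v y (MA.bv d j))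
            x (MA.bv d i) := by
  intro x hx
  have hv3 : ContDiffAt ℝ 3 v x := hv.contDiffAt (hU.mem_nhds hx)
  have hv2 : ContDiffAt ℝ 2 (fderiv ℝ v) x := hv3.fderiv_right (by norm_num)
  have hv1 : ContDiffAt ℝ 1 (fderiv ℝ (fderiv ℝ v)) x := hv2.fderiv_right (by norm_num)
  have hgrad : HasFDerivAt (fderiv ℝ v) (fderiv ℝ (fderiv ℝ v) x) x :=
    (hv2.differentiableAt (by norm_num)).hasFDerivAt
  have hhess := (hv1.differentiableAt (by norm_num)).hasFDerivAt
  set T := fderiv ℝ (fderiv ℝ (fderiv ℝ v)) x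
  have hsymm : ∀ a b, T a b = T b a := hv2.isSymmSndFDerivAt (by simp)
  set W : Fin d → Fin d → Fin d → ℝ :=
    fun i k => MA.components d (T (MA.bv d i) (MA.bv d k)) with hW
  have hterm : ∀ i : Fin d,
      fderiv ℝ (fun y => ∑ j : Fin d, MA.cof (MA.hess v y) i j * fderiv ℝ v y (MA.bv d j))
        x (MA.bv d i) = (MA.hess v x).det + ∑ k, (if k = i then 0 else
          (((MA.hess v x).updateRow i (MA.components d (fderiv ℝ v x))).updateRow k
            (W i k)).det) := by
    intro i
    have hfun : (fun y => ∑ j : Fin d, MA.cof (MA.hess v y) i j * fderiv ℝ v y (MA.bv d j)) =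
        fun y => ((MA.hess v y).updateRow i (MA.components d (fderiv ℝ v y))).det :=
      funext fun y => MA.sum_cof_mul _ (MA.components d (fderiv ℝ v y)) i
    have hrow : ∀ k, HasFDerivAt
        (fun y => (MA.hess v y).updateRow i (MA.components d (fderiv ℝ v y)) k)
        (if k = i then (MA.components d).comp (fderiv ℝ (fderiv ℝ v) x)
          else (MA.components d).comp (T.flip (MA.bv d k))) x := by
      intro k
      by_cases hk : k = i
      · subst hk
        simp only [Matrix.updateRow_self, if_true]
        exact (MA.components d).hasFDerivAt.comp x hgrad
      · simp only [Matrix.updateRow_ne hk, if_neg hk, MA.hess_row]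
        have happly : HasFDerivAt (fun y => fderiv ℝ (fderiv ℝ v) y (MA.bv d k))
            (T.flip (MA.bv d k)) x := by
          simpa using hhess.clm_apply (hasFDerivAt_const (MA.bv d k) x)
        exact (MA.components d).hasFDerivAt.comp x happly
    rw [hfun, HasFDerivAt.det_apply hrow, ← Finset.add_sum_erase _ _ (Finset.mem_univ i),
      ← Finset.add_sum_erase (a := i) _ (fun k => ite (k = i) _ _) (Finset.mem_univ i)]
    simp only [if_true, zero_add]
    congr 1
    · rw [ContinuousLinearMap.comp_apply, ← MA.hess_row, Matrix.updateRow_idem,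
        Matrix.updateRow_eq_self]
    · refine Finset.sum_congr rfl fun k hk => ?_
      simp only [if_neg (Finset.ne_of_mem_erase hk)]
      rfl
  rw [Finset.sum_congr rfl fun i _ => hterm i, Finset.sum_add_distrib,
    Matrix.sum_sum_det_updateRow_updateRow_eq_zero _ _ W
      fun i k => by simp only [hW, hsymm (MA.bv d i)]]
  simp
end
end
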